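/- Let (H^(0), H^(1), ..., H^(K)) be a reversible Markov chain of jointly Gaussian random vectors in R^d, where each H^(i) is marginally standard Gaussian and H^(i), H^(j) are (1-eps)^{|i-j|}-correlated (i.e., each adjacent pair is obtained by an Ornstein-Uhlenbeck step). Then for any measurable set S of R^d with P[H^(0) in S] = q, we have P[H^(i) in S for all 0 <= i <= K] >= q^{2^{floor(log_2 K)+1}} >= q^{4K}. -/

import Mathlib

open MeasureTheory ProbabilityTheory

/-- The standard Gaussian measure on `ℝ^d`. -/
noncomputable def stdGaussianPi (d : ℕ) : Measure (Fin d → ℝ) :=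
  Measure.pi fun _ => gaussianReal 0 1

/-- The Ornstein–Uhlenbeck Markov chain of standard Gaussian vectors in `ℝ^d`:
`H 0 = ξ 0` and `H (i+1) = p • H i + √(1-p²) • ξ (i+1)` where the `ξ j` are i.i.d.
standard Gaussian vectors; written in closed form so that `H i` and `H j` are
`p^{|i-j|}`-correlated. -/
noncomputable def ouChain (d K : ℕ) (p : ℝ) (ω : Fin (K + 1) → Fin d → ℝ) (i : ℕ) :
    Fin d → ℝ := fun t =>
  p ^ i * ω 0 t +
    ∑ j : Fin (K + 1),
      if 0 < (j : ℕ) ∧ (j : ℕ) ≤ i then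
        p ^ (i - (j : ℕ)) * Real.sqrt (1 - p ^ 2) * ω j t
      else 0

open scoped ENNReal

instance (d : ℕ) : IsProbabilityMeasure (stdGaussianPi d) := by
  unfold stdGaussianPi; infer_instance

theorem charFunDual_stdGaussianPi (d : ℕ) (M : StrongDual ℝ (Fin d → ℝ)) :
    charFunDual (stdGaussianPi d) M =
      Complex.exp (-∑ i, (M (Pi.single i 1) : ℂ) ^ 2 / 2) := by
  rw [stdGaussianPi, charFunDual_pi, ← Finset.sum_neg_distrib, Complex.exp_sum]
  refine Finset.prod_congr rfl fun i _ => ?_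
  have h : ∀ x : ℝ, (M ∘SL ContinuousLinearMap.single ℝ (fun _ : Fin d => ℝ) i) x =
      M (Pi.single i 1) * x := fun x => by
    have : (Pi.single i x : Fin d → ℝ) = x • Pi.single i 1 := by
      rw [← Pi.single_smul]; simp
    simp [this, mul_comm]
  rw [charFunDual_apply]
  simp_rw [h, Complex.ofReal_mul]
  rw [← charFun_apply_real, charFun_gaussianReal]
  simp

/-- The reflection `(x, y) ↦ (c x + s y, s x - c y)`. -/
noncomputable def gaussianReflection (d : ℕ) (c s : ℝ) :
    (Fin d → ℝ) × (Fin d → ℝ) →L[ℝ] (Fin d → ℝ) × (Fin d → ℝ) :=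
  ContinuousLinearMap.prod (c • ContinuousLinearMap.fst ℝ _ _ + s • ContinuousLinearMap.snd ℝ _ _)
    (s • ContinuousLinearMap.fst ℝ _ _ - c • ContinuousLinearMap.snd ℝ _ _)

theorem gaussianReflection_apply (d : ℕ) (c s : ℝ) (z : (Fin d → ℝ) × (Fin d → ℝ)) :
    gaussianReflection d c s z = (c • z.1 + s • z.2, s • z.1 - c • z.2) := rfl

theorem measurePreserving_gaussianReflection (d : ℕ) {c s : ℝ} (h : c ^ 2 + s ^ 2 = 1) :
    MeasurePreserving (gaussianReflection d c s)
      ((stdGaussianPi d).prod (stdGaussianPi d)) ((stdGaussianPi d).prod (stdGaussianPi d)) := by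
  refine ⟨(gaussianReflection d c s).continuous.measurable, Measure.ext_of_charFunDual ?_⟩
  ext L
  rw [charFunDual_map, charFunDual_prod, charFunDual_prod]
  simp_rw [charFunDual_stdGaussianPi, ← Complex.exp_add, ← neg_add, ← Finset.sum_add_distrib]
  congr 2
  refine Finset.sum_congr rfl fun i _ => ?_
  set e : Fin d → ℝ := Pi.single i 1
  have hL : ∀ x y : Fin d → ℝ, L (x, y) = L (x, 0) + L (0, y) := fun x y => by
    rw [← map_add]; simp
  have h1 : ∀ a : ℝ, L (a • e, 0) = a * L (e, 0) := fun a => by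
    rw [← smul_eq_mul, ← map_smul]; simp
  have h2 : ∀ a : ℝ, L (0, a • e) = a * L (0, e) := fun a => by
    rw [← smul_eq_mul, ← map_smul]; simp
  have h3 : L (0, -(c • e)) = -(c * L (0, e)) := by
    rw [← neg_smul, h2]; ring
  simp only [ContinuousLinearMap.comp_apply, ContinuousLinearMap.inl_apply,
    ContinuousLinearMap.inr_apply, gaussianReflection_apply, smul_zero, add_zero, zero_add,
    sub_zero, zero_sub]
  rw [hL (c • e) (s • e), hL (s • e), h1, h1, h2, h3]
  norm_cast
  linear_combination ((L (e, 0) ^ 2 + L (0, e) ^ 2) / 2) * h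

/-- The Ornstein–Uhlenbeck operator with correlation `p`. -/
noncomputable def ouOp (d : ℕ) (p : ℝ) (f : (Fin d → ℝ) → ℝ≥0∞) (x : Fin d → ℝ) : ℝ≥0∞ :=
  ∫⁻ y, f (p • x + √(1 - p ^ 2) • y) ∂stdGaussianPi d

theorem measurable_ouOp {d : ℕ} (p : ℝ) {f : (Fin d → ℝ) → ℝ≥0∞} (hf : Measurable f) :
    Measurable (ouOp d p f) := by
  unfold ouOp
  exact Measurable.lintegral_prod_right' (f := fun z : (Fin d → ℝ) × (Fin d → ℝ) =>
    f (p • z.1 + √(1 - p ^ 2) • z.2)) (hf.comp (by fun_prop))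

theorem ouOp_mono {d : ℕ} (p : ℝ) {f g : (Fin d → ℝ) → ℝ≥0∞} (h : f ≤ g) :
    ouOp d p f ≤ ouOp d p g := fun _ => lintegral_mono fun _ => h _

/-- Rotation invariance of a pair of independent standard Gaussian vectors. -/
theorem lintegral_lintegral_reflection {d : ℕ} {c s : ℝ} (h : c ^ 2 + s ^ 2 = 1)
    {F : (Fin d → ℝ) × (Fin d → ℝ) → ℝ≥0∞} (hF : Measurable F) :
    ∫⁻ x, ∫⁻ y, F (c • x + s • y, s • x - c • y) ∂stdGaussianPi d ∂stdGaussianPi d =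
      ∫⁻ x, ∫⁻ y, F (x, y) ∂stdGaussianPi d ∂stdGaussianPi d := by
  have hR := measurePreserving_gaussianReflection d h
  rw [← lintegral_prod _ hF.aemeasurable, ← hR.lintegral_comp hF,
    lintegral_prod (fun z => F (gaussianReflection d c s z))
      (hF.comp hR.measurable).aemeasurable]
  rfl

theorem lintegral_linear_combination {d : ℕ} {c s : ℝ} (h : c ^ 2 + s ^ 2 = 1)
    {f : (Fin d → ℝ) → ℝ≥0∞} (hf : Measurable f) :
    ∫⁻ x, ∫⁻ y, f (c • x + s • y) ∂stdGaussianPi d ∂stdGaussianPi d =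
      ∫⁻ x, f x ∂stdGaussianPi d := by
  rw [lintegral_lintegral_reflection h (F := fun z => f z.1) (hf.comp measurable_fst)]
  simp

theorem sq_add_sqrt_one_sub_sq {p : ℝ} (hp : p ∈ Set.Icc (0 : ℝ) 1) :
    p ^ 2 + √(1 - p ^ 2) ^ 2 = 1 := by
  rw [Real.sq_sqrt (by nlinarith [hp.1, hp.2])]; ring

theorem lintegral_ouOp {d : ℕ} {p : ℝ} (hp : p ∈ Set.Icc (0 : ℝ) 1)
    {f : (Fin d → ℝ) → ℝ≥0∞} (hf : Measurable f) :
    ∫⁻ x, ouOp d p f x ∂stdGaussianPi d = ∫⁻ x, f x ∂stdGaussianPi d :=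
  lintegral_linear_combination (sq_add_sqrt_one_sub_sq hp) hf

/-- The Ornstein–Uhlenbeck operator is self-adjoint. -/
theorem lintegral_mul_ouOp_comm {d : ℕ} {p : ℝ} (hp : p ∈ Set.Icc (0 : ℝ) 1)
    {f g : (Fin d → ℝ) → ℝ≥0∞} (hf : Measurable f) (hg : Measurable g) :
    ∫⁻ x, f x * ouOp d p g x ∂stdGaussianPi d = ∫⁻ x, ouOp d p f x * g x ∂stdGaussianPi d := by
  have h := sq_add_sqrt_one_sub_sq hp
  set s := √(1 - p ^ 2)
  have e1 : ∫⁻ x, f x * ouOp d p g x ∂stdGaussianPi d =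
      ∫⁻ x, ∫⁻ y, f x * g (p • x + s • y) ∂stdGaussianPi d ∂stdGaussianPi d := by
    refine lintegral_congr fun x => ?_
    exact (lintegral_const_mul _ (by fun_prop)).symm
  have e2 : ∫⁻ x, ouOp d p f x * g x ∂stdGaussianPi d =
      ∫⁻ x, ∫⁻ y, f (p • x + s • y) * g x ∂stdGaussianPi d ∂stdGaussianPi d := by
    refine lintegral_congr fun x => ?_
    exact (lintegral_mul_const _ (by fun_prop)).symm
  rw [e1, e2, ← lintegral_lintegral_reflection h
    (F := fun z => f z.1 * g (p • z.1 + s • z.2))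
    ((hf.comp measurable_fst).mul (hg.comp (by fun_prop)))]
  refine lintegral_congr fun x => lintegral_congr fun y => ?_
  congr 2
  have : p • (p • x + s • y) + s • (s • x - p • y) = (p ^ 2 + s ^ 2) • x := by module
  simp only [this, h, one_smul]

/-- The semigroup property of the Ornstein–Uhlenbeck operators. -/
theorem ouOp_ouOp {d : ℕ} {r : ℝ} (hr : r ∈ Set.Icc (0 : ℝ) 1)
    {f : (Fin d → ℝ) → ℝ≥0∞} (hf : Measurable f) :
    ouOp d r (ouOp d r f) = ouOp d (r ^ 2) f := by
  ext x
  unfold ouOp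
  have hr2 : r ^ 2 ≤ 1 := by nlinarith [hr.1, hr.2]
  have h1 : √(1 - r ^ 2) ^ 2 = 1 - r ^ 2 := Real.sq_sqrt (by linarith)
  have h2 : √(1 - (r ^ 2) ^ 2) ^ 2 = 1 - (r ^ 2) ^ 2 :=
    Real.sq_sqrt (by nlinarith [sq_nonneg r])
  set s := √(1 - r ^ 2)
  set t := √(1 - (r ^ 2) ^ 2)
  have ht0 : 0 ≤ t := Real.sqrt_nonneg _
  by_cases ht : t = 0
  · have hs : s = 0 := by
      have : s ^ 2 * (1 + r ^ 2) = 0 := by rw [h1]; rw [ht] at h2; linarith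
      have h3 : (1 + r ^ 2) ≠ 0 := by positivity
      simpa [h3] using this
    simp only [hs, ht, zero_smul, add_zero, lintegral_const, measure_univ, mul_one, smul_smul, sq]
  · have hc : (r * s / t) ^ 2 + (s / t) ^ 2 = 1 := by
      field_simp
      rw [h2, h1]; ring
    rw [← lintegral_linear_combination hc
      (f := fun y => f (r ^ 2 • x + t • y)) (hf.comp (by fun_prop))]
    refine lintegral_congr fun y => lintegral_congr fun z => ?_
    congr 1
    rw [smul_add t, smul_smul t, smul_smul t, mul_div_cancel₀ _ ht, mul_div_cancel₀ _ ht]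
    module

theorem sq_lintegral_le_lintegral_sq {α : Type*} [MeasurableSpace α] (μ : Measure α)
    [IsProbabilityMeasure μ] {f : α → ℝ≥0∞} (hf : Measurable f) :
    (∫⁻ x, f x ∂μ) ^ 2 ≤ ∫⁻ x, f x ^ 2 ∂μ := by
  have h := ENNReal.lintegral_mul_le_Lp_mul_Lq μ Real.HolderConjugate.two_two
    hf.aemeasurable (aemeasurable_const (b := (1 : ℝ≥0∞)))
  simp only [Pi.mul_apply, mul_one, ENNReal.one_rpow, lintegral_const, measure_univ,
    ENNReal.rpow_two, one_pow] at h
  calc (∫⁻ x, f x ∂μ) ^ 2 ≤ ((∫⁻ x, f x ^ 2 ∂μ) ^ (1 / 2 : ℝ)) ^ 2 := by gcongr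
    _ = _ := by rw [← ENNReal.rpow_two, ← ENNReal.rpow_mul]; simp

theorem sq_lintegral_le_lintegral_mul_ouOp {d : ℕ} {p : ℝ} (hp : p ∈ Set.Icc (0 : ℝ) 1)
    {f : (Fin d → ℝ) → ℝ≥0∞} (hf : Measurable f) :
    (∫⁻ x, f x ∂stdGaussianPi d) ^ 2 ≤ ∫⁻ x, f x * ouOp d p f x ∂stdGaussianPi d := by
  have hr : √p ∈ Set.Icc (0 : ℝ) 1 := ⟨Real.sqrt_nonneg _, Real.sqrt_le_one.2 hp.2⟩
  have hm := measurable_ouOp √p hf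
  have hT : ouOp d p f = ouOp d √p (ouOp d √p f) := by
    rw [ouOp_ouOp hr hf, Real.sq_sqrt hp.1]
  rw [hT, lintegral_mul_ouOp_comm hr hf hm, ← lintegral_ouOp hr hf]
  simpa only [sq] using sq_lintegral_le_lintegral_sq (stdGaussianPi d) hm

/-- `ouSurvival d p S n x` is the probability that the first `n` steps of the chain started
at `x` lie in `S`. -/
noncomputable def ouSurvival (d : ℕ) (p : ℝ) (S : Set (Fin d → ℝ)) :
    ℕ → (Fin d → ℝ) → ℝ≥0∞
  | 0 => 1
  | n + 1 => ouOp d p (S.indicator (ouSurvival d p S n))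

section Survival

variable {d : ℕ} {p : ℝ} {S : Set (Fin d → ℝ)}

theorem measurable_ouSurvival (hS : MeasurableSet S) (n : ℕ) :
    Measurable (ouSurvival d p S n) := by
  induction n with
  | zero => exact measurable_const
  | succ n ih => exact measurable_ouOp p (ih.indicator hS)

theorem ouSurvival_antitone : Antitone (ouSurvival d p S) := by
  refine antitone_nat_of_succ_le fun n => ?_
  induction n with
  | zero =>
    intro x
    calc ouSurvival d p S 1 x ≤ ouOp d p 1 x :=
          ouOp_mono p (Set.indicator_le_self' fun _ _ => zero_le) x
      _ = 1 := by simp [ouOp]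
  | succ n ih => exact ouOp_mono p (Set.indicator_mono ih)

theorem lintegral_ouSurvival_mul_ouOp (hp : p ∈ Set.Icc (0 : ℝ) 1) (hS : MeasurableSet S)
    (m n : ℕ) :
    ∫⁻ x, S.indicator (ouSurvival d p S m) x *
        ouOp d p (S.indicator (ouSurvival d p S n)) x ∂stdGaussianPi d =
      ∫⁻ x, S.indicator (ouSurvival d p S (m + n + 1)) x ∂stdGaussianPi d := by
  have hm := fun k => (measurable_ouSurvival (d := d) (p := p) hS k).indicator hS
  induction m generalizing n with
  | zero =>
    refine lintegral_congr fun x => ?_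
    by_cases hx : x ∈ S <;> simp [hx, ouSurvival]
  | succ m ih =>
    rw [show m + 1 + n + 1 = m + (n + 1) + 1 by ring, ← ih (n + 1),
      lintegral_mul_ouOp_comm hp (hm m) (hm (n + 1))]
    refine lintegral_congr fun x => ?_
    by_cases hx : x ∈ S <;> simp [hx, ouSurvival]

theorem pow_le_lintegral_ouSurvival (hp : p ∈ Set.Icc (0 : ℝ) 1) (hS : MeasurableSet S)
    (m : ℕ) :
    stdGaussianPi d S ^ 2 ^ m ≤
      ∫⁻ x, S.indicator (ouSurvival d p S (2 ^ m - 1)) x ∂stdGaussianPi d := by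
  induction m with
  | zero => simp [ouSurvival, lintegral_indicator hS]
  | succ m ih =>
    have hpos : 0 < 2 ^ m := by positivity
    have e : 2 ^ (m + 1) - 1 = (2 ^ m - 1) + (2 ^ m - 1) + 1 := by rw [pow_succ]; omega
    rw [e, ← lintegral_ouSurvival_mul_ouOp hp hS, pow_succ, pow_mul]
    exact (pow_le_pow_left' ih 2).trans (sq_lintegral_le_lintegral_mul_ouOp hp
      ((measurable_ouSurvival hS _).indicator hS))

end Survival

theorem ouChain_zero (d K : ℕ) (p : ℝ) (ω : Fin (K + 1) → Fin d → ℝ) :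
    ouChain d K p ω 0 = ω 0 := by
  ext t
  have : ∀ j : Fin (K + 1), ¬ (0 < (j : ℕ) ∧ (j : ℕ) ≤ 0) := fun j => by omega
  simp only [ouChain, this, if_false]
  simp

theorem ouChain_castSucc (d K : ℕ) (p : ℝ) (ω : Fin (K + 2) → Fin d → ℝ) {i : ℕ}
    (hi : i ≤ K) :
    ouChain d (K + 1) p ω i = ouChain d K p (fun j => ω j.castSucc) i := by
  ext t
  have : ¬ (K + 1 ≤ i) := by omega
  simp [ouChain, Fin.sum_univ_castSucc, this]

theorem ouChain_last (d K : ℕ) (p : ℝ) (ω : Fin (K + 2) → Fin d → ℝ) :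
    ouChain d (K + 1) p ω (K + 1) =
      p • ouChain d K p (fun j => ω j.castSucc) K +
        √(1 - p ^ 2) • ω (Fin.last (K + 1)) := by
  ext t
  simp only [ouChain, Fin.sum_univ_castSucc (n := K + 1), Fin.val_castSucc, Fin.val_last,
    Pi.add_apply, Pi.smul_apply, smul_eq_mul, mul_add, Finset.mul_sum, Fin.castSucc_zero]
  have hsum : ∀ j : Fin (K + 1),
      (if 0 < (j : ℕ) ∧ (j : ℕ) ≤ K + 1 then
        p ^ (K + 1 - (j : ℕ)) * √(1 - p ^ 2) * ω j.castSucc t else 0) =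
      p * (if 0 < (j : ℕ) ∧ (j : ℕ) ≤ K then
        p ^ (K - (j : ℕ)) * √(1 - p ^ 2) * ω j.castSucc t else 0) := fun j => by
    have hj : (j : ℕ) ≤ K := by omega
    by_cases h0 : 0 < (j : ℕ)
    · rw [if_pos ⟨h0, by omega⟩, if_pos ⟨h0, hj⟩, Nat.sub_add_comm hj, pow_succ]; ring
    · simp [h0]
  simp_rw [hsum]
  simp [pow_succ]
  ring

theorem measurable_ouChain (d K : ℕ) (p : ℝ) (i : ℕ) :
    Measurable fun ω => ouChain d K p ω i := by
  refine measurable_pi_lambda _ fun t => ?_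
  unfold ouChain
  refine Measurable.add (by fun_prop) (Finset.measurable_sum _ fun j _ => ?_)
  split_ifs <;> fun_prop

theorem measurableSet_ouChain {d : ℕ} (K : ℕ) (p : ℝ) {S : Set (Fin d → ℝ)}
    (hS : MeasurableSet S) :
    MeasurableSet {ω : Fin (K + 1) → Fin d → ℝ | ∀ i ≤ K, ouChain d K p ω i ∈ S} := by
  simp only [Set.ofPred_forall]
  exact MeasurableSet.iInter fun i => MeasurableSet.iInter fun _ => measurable_ouChain d K p i hS

theorem measurePreserving_ouNoise_zero (d K : ℕ) :
    MeasurePreserving (fun ω : Fin (K + 1) → Fin d → ℝ => ω 0)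
      (Measure.pi fun _ => stdGaussianPi d) (stdGaussianPi d) :=
  measurePreserving_eval (fun _ : Fin (K + 1) => stdGaussianPi d) 0

/-- The Markov property of the chain at time `K`. -/
theorem lintegral_indicator_ouChain_succ {d : ℕ} (K : ℕ) (p : ℝ) {S : Set (Fin d → ℝ)}
    (hS : MeasurableSet S) {f : (Fin d → ℝ) → ℝ≥0∞} (hf : Measurable f) :
    ∫⁻ ω, Set.indicator {ω | ∀ i ≤ K + 1, ouChain d (K + 1) p ω i ∈ S}
        (fun ω => f (ouChain d (K + 1) p ω (K + 1))) ω
        ∂(Measure.pi fun _ : Fin (K + 2) => stdGaussianPi d) =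
      ∫⁻ ω, Set.indicator {ω | ∀ i ≤ K, ouChain d K p ω i ∈ S}
        (fun ω => ouOp d p (S.indicator f) (ouChain d K p ω K)) ω
        ∂(Measure.pi fun _ : Fin (K + 1) => stdGaussianPi d) := by
  have hE := measurableSet_ouChain K p hS
  set E := {ω : Fin (K + 1) → Fin d → ℝ | ∀ i ≤ K, ouChain d K p ω i ∈ S}
  have hmp := measurePreserving_piFinSuccAbove (fun _ : Fin (K + 2) => stdGaussianPi d)
    (Fin.last (K + 1))
  let G : (Fin d → ℝ) × (Fin (K + 1) → Fin d → ℝ) → ℝ≥0∞ := fun z =>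
    E.indicator 1 z.2 * S.indicator f (p • ouChain d K p z.2 K + √(1 - p ^ 2) • z.1)
  have hc := measurable_ouChain d K p K
  have hG : Measurable G := by
    refine ((measurable_one.indicator hE).comp measurable_snd).mul ((hf.indicator hS).comp ?_)
    have : Measurable fun z : (Fin d → ℝ) × (Fin (K + 1) → Fin d → ℝ) => ouChain d K p z.2 K :=
      hc.comp measurable_snd
    fun_prop
  have hpt : ∀ ω : Fin (K + 2) → Fin d → ℝ,
      Set.indicator {ω | ∀ i ≤ K + 1, ouChain d (K + 1) p ω i ∈ S}
        (fun ω => f (ouChain d (K + 1) p ω (K + 1))) ω =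
      G (MeasurableEquiv.piFinSuccAbove (fun _ => Fin d → ℝ) (Fin.last (K + 1)) ω) := by
    intro ω
    have he : MeasurableEquiv.piFinSuccAbove (fun _ => Fin d → ℝ) (Fin.last (K + 1)) ω =
        (ω (Fin.last (K + 1)), fun j => ω j.castSucc) := by
      simp [MeasurableEquiv.piFinSuccAbove, Fin.insertNthEquiv, Fin.init_def]
    have hiff : (∀ i ≤ K + 1, ouChain d (K + 1) p ω i ∈ S) ↔
        (fun j => ω j.castSucc) ∈ E ∧ ouChain d (K + 1) p ω (K + 1) ∈ S := by
      refine ⟨fun h => ⟨fun i hi => ?_, h _ le_rfl⟩, fun h i hi => ?_⟩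
      · rw [← ouChain_castSucc d K p ω hi]; exact h i (by omega)
      · rcases Nat.le_succ_iff.1 hi with hi | rfl
        · rw [ouChain_castSucc d K p ω hi]; exact h.1 i hi
        · exact h.2
    simp only [he, G, ← ouChain_last]
    by_cases h1 : (fun j => ω j.castSucc) ∈ E <;>
      by_cases h2 : ouChain d (K + 1) p ω (K + 1) ∈ S <;>
      simp [Set.indicator, hiff, h1, h2]
  simp_rw [hpt]
  rw [hmp.lintegral_comp hG, lintegral_prod_symm _ hG.aemeasurable]
  refine lintegral_congr fun ω => ?_
  by_cases h : ω ∈ E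
  · simp [G, h, ouOp]
  · simp [G, h]

theorem lintegral_indicator_ouSurvival {d : ℕ} (K n : ℕ) (p : ℝ) {S : Set (Fin d → ℝ)}
    (hS : MeasurableSet S) :
    ∫⁻ ω, Set.indicator {ω | ∀ i ≤ K, ouChain d K p ω i ∈ S}
        (fun ω => ouSurvival d p S n (ouChain d K p ω K)) ω
        ∂(Measure.pi fun _ : Fin (K + 1) => stdGaussianPi d) =
      ∫⁻ x, S.indicator (ouSurvival d p S (n + K)) x ∂stdGaussianPi d := by
  induction K generalizing n with
  | zero =>
    rw [← (measurePreserving_ouNoise_zero d 0).lintegral_comp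
      ((measurable_ouSurvival hS _).indicator hS)]
    refine lintegral_congr fun ω => ?_
    by_cases h : ω 0 ∈ S <;> simp [Set.indicator, ouChain_zero, h]
  | succ K ih =>
    rw [lintegral_indicator_ouChain_succ K p hS (measurable_ouSurvival hS n),
      show n + (K + 1) = n + 1 + K by ring, ← ih (n + 1)]
    rfl

theorem measure_ouChain_eq {d : ℕ} (K : ℕ) (p : ℝ) {S : Set (Fin d → ℝ)}
    (hS : MeasurableSet S) :
    (Measure.pi fun _ : Fin (K + 1) => stdGaussianPi d) {ω | ∀ i ≤ K, ouChain d K p ω i ∈ S} =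
      ∫⁻ x, S.indicator (ouSurvival d p S K) x ∂stdGaussianPi d := by
  have h := lintegral_indicator_ouSurvival K 0 p hS
  rw [zero_add] at h
  rw [← h, lintegral_indicator (measurableSet_ouChain K p hS)]
  simp [ouSurvival]

/-- Positive-correlation along the reversible Gaussian OU chain: if each `H i` is marginally
standard Gaussian and `H i, H j` are `(1-ε)^{|i-j|}`-correlated, then for any measurable `S`
with `q = P[H 0 ∈ S]`, we have `P[∀ i ≤ K, H i ∈ S] ≥ q^(2^(⌊log₂ K⌋+1)) ≥ q^(4K)`. -/
theorem stmt_3 (d K : ℕ) (hK : 1 ≤ K) (ε : ℝ) (hε : ε ∈ Set.Ioo (0 : ℝ) 1)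
    (S : Set (Fin d → ℝ)) (hS : MeasurableSet S) (q : ℝ)
    (hq : q = ((Measure.pi fun _ : Fin (K + 1) => stdGaussianPi d)
        {ω | ouChain d K (1 - ε) ω 0 ∈ S}).toReal) :
    q ^ (4 * K) ≤ q ^ (2 ^ (Nat.log 2 K + 1)) ∧
    q ^ (2 ^ (Nat.log 2 K + 1)) ≤
      ((Measure.pi fun _ : Fin (K + 1) => stdGaussianPi d)
        {ω | ∀ i ≤ K, ouChain d K (1 - ε) ω i ∈ S}).toReal := by
  have hp : 1 - ε ∈ Set.Icc (0 : ℝ) 1 := ⟨by linarith [hε.2], by linarith [hε.1]⟩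
  have hq' : q = (stdGaussianPi d S).toReal := by
    rw [hq]
    simp_rw [ouChain_zero]
    rw [← (measurePreserving_ouNoise_zero d K).measure_preimage hS.nullMeasurableSet]
    rfl
  have hq0 : 0 ≤ q := hq' ▸ ENNReal.toReal_nonneg
  have hq1 : q ≤ 1 := hq' ▸ measureReal_le_one
  constructor
  · refine pow_le_pow_of_le_one hq0 hq1 ?_
    have := Nat.pow_log_le_self 2 (show K ≠ 0 by omega)
    rw [pow_succ]; omega
  · rw [hq', ← ENNReal.toReal_pow]
    refine ENNReal.toReal_mono (measure_ne_top _ _) ?_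
    rw [measure_ouChain_eq K _ hS]
    refine (pow_le_lintegral_ouSurvival hp hS _).trans (lintegral_mono ?_)
    have := Nat.lt_pow_succ_log_self (b := 2) (by norm_num) K
    exact Set.indicator_mono (ouSurvival_antitone (by omega))
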